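/- arXiv:math/0502409 — 2 statements merged into one kernel-verified Lean document; each statement's English description precedes it below -/
import Mathlib

section
/- The map β̃ : 𝓔(V_1(ρ_1,η_1), V_2(ρ_2,η_2)) → Ext¹_{𝔞[t]}(V_1(ρ_1,η_1), V_2(ρ_2,η_2)) sending η̃ to the class of the extension (V(ρ,η+η̃), ι_0, π_0) is a linear map of vector spaces (with respect to the Baer sum and scalar multiplication on Ext¹), and its kernel is exactly 𝓔_0(V_1(ρ_1,η_1), V_2(ρ_2,η_2)). In particular, 𝓔_0 is a linear subspace of 𝓔. -/
open TensorAlgebra TensorProduct Polynomial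

noncomputable section

/-- The graded pieces `F^r(a)` of the free Lie algebra on the vector space `a`,
realized inside the tensor algebra `T(a)`:  `F¹(a) = ι(a)` and `F^{r+1}(a)` is spanned by
the commutators `ι(x) * y - y * ι(x)` with `x ∈ a`, `y ∈ F^r(a)`. -/
def Fr (a : Type*) [LieRing a] [LieAlgebra ℂ a] : ℕ → Submodule ℂ (TensorAlgebra ℂ a)
  | 0 => ⊥
  | 1 => LinearMap.range (TensorAlgebra.ι ℂ (M := a))
  | (r + 2) => Submodule.span ℂ
      {u | ∃ (x : a) (y : TensorAlgebra ℂ a), y ∈ Fr a (r + 1) ∧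
        u = TensorAlgebra.ι ℂ x * y - y * TensorAlgebra.ι ℂ x}

/-- The free Lie algebra `F(a) = ⊕_{r>0} F^r(a)` on the vector space `a`,
as a subspace of the tensor algebra. -/
def FLie (a : Type*) [LieRing a] [LieAlgebra ℂ a] : Submodule ℂ (TensorAlgebra ℂ a) :=
  ⨆ r, Fr a r

/-- `IsTau a τ` says that the linear map `τ` is (a linear extension to `T(a)` of) the canonical
Lie algebra homomorphism `τ : F(a) → a`: it is the identity on `F¹(a) = a` and takes the
commutator bracket of `T(a)` (restricted to `F(a)`) to the bracket of `a`. -/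
def IsTau (a : Type*) [LieRing a] [LieAlgebra ℂ a] (τ : TensorAlgebra ℂ a →ₗ[ℂ] a) : Prop :=
  (∀ x : a, τ (TensorAlgebra.ι ℂ x) = x) ∧
  ∀ r s : ℕ, ∀ u ∈ Fr a r, ∀ v ∈ Fr a s, τ (u * v - v * u) = ⁅τ u, τ v⁆

/-- The current algebra `a[t] = a ⊗ ℂ[t]`, with bracket `⁅x ⊗ f, y ⊗ g⁆ = ⁅x, y⁆ ⊗ fg`. -/
abbrev Cur (a : Type*) [LieRing a] [LieAlgebra ℂ a] : Type _ := Polynomial ℂ ⊗[ℂ] a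

/-- `IsTauT a τ τt` says that the linear map `τt` is (a linear extension to `T(a)` of) the map
`τ[t] : F(a) → a[t]` given by `τ[t](𝐱) = τ(𝐱) ⊗ t^r` for `𝐱 ∈ F^r(a)`. -/
def IsTauT (a : Type*) [LieRing a] [LieAlgebra ℂ a] (τ : TensorAlgebra ℂ a →ₗ[ℂ] a)
    (τt : TensorAlgebra ℂ a →ₗ[ℂ] Cur a) : Prop :=
  ∀ r : ℕ, ∀ u ∈ Fr a r, τt u = ((X : ℂ[X]) ^ r) ⊗ₜ[ℂ] (τ u)

end

noncomputable section

/-- `MemH a V τ ρ η`, i.e. `(ρ, η) ∈ ℋ(V)`:  `ρ` is a Lie algebra homomorphism (C1), `η` is a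
homomorphism of `a`-modules for the `a`-module structure on `End V` induced by `ρ` (C2), and
`ker τ_r ⊆ ker η^{⊙r}` for all `r > 0` (C3), where `η^{⊙r}` is the restriction to
`F^r(a) ⊆ T^r(a)` of the algebra homomorphism `η_T : T(a) → End V` extending `η`. -/
def MemH (a : Type*) [LieRing a] [LieAlgebra ℂ a] {V : Type*} [AddCommGroup V] [Module ℂ V]
    (τ : TensorAlgebra ℂ a →ₗ[ℂ] a) (ρ η : a →ₗ[ℂ] Module.End ℂ V) : Prop :=
  (∀ x y : a, ρ ⁅x, y⁆ = ⁅ρ x, ρ y⁆) ∧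
  (∀ x y : a, η ⁅x, y⁆ = ⁅ρ x, η y⁆) ∧
  (∀ r : ℕ, ∀ u ∈ Fr a r, τ u = 0 → TensorAlgebra.lift ℂ η u = 0)

/-- `IsCurHom a ρ₁ η₁ ρ₂ η₂ φ` says that the linear map `φ : V₁ → V₂` is a homomorphism of
`a[t]`-modules from `V₁(ρ₁, η₁)` to `V₂(ρ₂, η₂)`: it intertwines the actions of `x ⊗ 1`
(given by `ρᵢ`) and of `x ⊗ t^r` (given by `ηᵢ^{⊙r}(𝐱)` for `𝐱 ∈ F^r(a)` with `τ_r(𝐱) = x`). -/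
def IsCurHom (a : Type*) [LieRing a] [LieAlgebra ℂ a]
    {V1 V2 : Type*} [AddCommGroup V1] [Module ℂ V1] [AddCommGroup V2] [Module ℂ V2]
    (ρ1 η1 : a →ₗ[ℂ] Module.End ℂ V1) (ρ2 η2 : a →ₗ[ℂ] Module.End ℂ V2)
    (φ : V1 →ₗ[ℂ] V2) : Prop :=
  (∀ x : a, φ ∘ₗ ρ1 x = ρ2 x ∘ₗ φ) ∧
  ∀ r : ℕ, ∀ u ∈ Fr a r,
    φ ∘ₗ (TensorAlgebra.lift ℂ η1 u : Module.End ℂ V1)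
      = (TensorAlgebra.lift ℂ η2 u : Module.End ℂ V2) ∘ₗ φ

end

noncomputable section

variable (a : Type*) [LieRing a] [LieAlgebra ℂ a]
variable (V1 V2 : Type*) [AddCommGroup V1] [Module ℂ V1] [AddCommGroup V2] [Module ℂ V2]

/-- The space `Hom_a(V₁, V₂)` of `a`-module homomorphisms, as a subspace of `Hom(V₁,V₂)`. -/
def homA (ρ1 : a →ₗ[ℂ] Module.End ℂ V1) (ρ2 : a →ₗ[ℂ] Module.End ℂ V2) :
    Submodule ℂ (V1 →ₗ[ℂ] V2) where
  carrier := {ψ | ∀ x : a, ψ ∘ₗ ρ1 x = ρ2 x ∘ₗ ψ}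
  add_mem' := by
    intro f g hf hg x
    ext v
    simp only [LinearMap.add_comp, LinearMap.comp_add, hf x, hg x]
  zero_mem' := by
    intro x
    ext v
    simp
  smul_mem' := by
    intro c f hf x
    ext v
    simp only [LinearMap.smul_comp, LinearMap.comp_smul, hf x]

/-- The space `Hom_{a[t]}(V₁(ρ₁,η₁), V₂(ρ₂,η₂))` of `a[t]`-module homomorphisms. -/
def homAt (ρ1 η1 : a →ₗ[ℂ] Module.End ℂ V1) (ρ2 η2 : a →ₗ[ℂ] Module.End ℂ V2) :
    Submodule ℂ (V1 →ₗ[ℂ] V2) where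
  carrier := {ψ | IsCurHom a ρ1 η1 ρ2 η2 ψ}
  add_mem' := by
    intro f g hf hg
    refine ⟨fun x => ?_, fun r u hu => ?_⟩
    · ext v; simp only [LinearMap.add_comp, LinearMap.comp_add, hf.1 x, hg.1 x]
    · ext v; simp only [LinearMap.add_comp, LinearMap.comp_add, hf.2 r u hu, hg.2 r u hu]
  zero_mem' := by
    refine ⟨fun x => ?_, fun r u hu => ?_⟩ <;> (ext v; simp)
  smul_mem' := by
    intro c f hf
    refine ⟨fun x => ?_, fun r u hu => ?_⟩
    · ext v; simp only [LinearMap.smul_comp, LinearMap.comp_smul, hf.1 x]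
    · ext v; simp only [LinearMap.smul_comp, LinearMap.comp_smul, hf.2 r u hu]

/-- The space `Hom_a(a, Hom(V₁,V₂))` of `a`-module homomorphisms from the adjoint module to
`Hom(V₁,V₂)` (the latter an `a`-module via `ρ₁`, `ρ₂`). -/
def homAa (ρ1 : a →ₗ[ℂ] Module.End ℂ V1) (ρ2 : a →ₗ[ℂ] Module.End ℂ V2) :
    Submodule ℂ (a →ₗ[ℂ] (V1 →ₗ[ℂ] V2)) where
  carrier := {θ | ∀ x y : a, θ ⁅x, y⁆ = ρ2 x ∘ₗ θ y - θ y ∘ₗ ρ1 x}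
  add_mem' := by
    intro f g hf hg x y
    ext v
    simp only [map_add, LinearMap.add_apply, LinearMap.comp_add, LinearMap.add_comp, hf x y,
      hg x y, LinearMap.sub_apply]
    abel
  zero_mem' := by intro x y; simp
  smul_mem' := by
    intro c f hf x y
    ext v
    simp only [map_smul, LinearMap.smul_apply, LinearMap.comp_smul, LinearMap.smul_comp,
      hf x y, LinearMap.sub_apply, smul_sub]

/-- The linear map `ψ ↦ η̃_ψ = (x ↦ η₂(x) ∘ ψ - ψ ∘ η₁(x))`. -/
def etaTildeMap (η1 : a →ₗ[ℂ] Module.End ℂ V1) (η2 : a →ₗ[ℂ] Module.End ℂ V2) :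
    (V1 →ₗ[ℂ] V2) →ₗ[ℂ] (a →ₗ[ℂ] (V1 →ₗ[ℂ] V2)) where
  toFun ψ :=
    { toFun := fun x => η2 x ∘ₗ ψ - ψ ∘ₗ η1 x
      map_add' := by
        intro x y
        simp only [map_add, LinearMap.add_comp, LinearMap.comp_add]
        abel
      map_smul' := by
        intro c x
        simp only [map_smul, LinearMap.smul_comp, LinearMap.comp_smul, RingHom.id_apply,
          smul_sub] }
  map_add' := by
    intro f g
    ext x v
    simp only [LinearMap.coe_mk, AddHom.coe_mk, LinearMap.add_apply, LinearMap.comp_add,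
      LinearMap.add_comp, LinearMap.sub_apply]
    abel
  map_smul' := by
    intro c f
    ext x v
    simp only [LinearMap.coe_mk, AddHom.coe_mk, LinearMap.smul_apply, LinearMap.comp_smul,
      LinearMap.smul_comp, RingHom.id_apply, LinearMap.sub_apply, smul_sub]

end

noncomputable section

variable (a : Type*) [LieRing a] [LieAlgebra ℂ a]
variable (V1 V2 : Type*) [AddCommGroup V1] [Module ℂ V1] [AddCommGroup V2] [Module ℂ V2]

/-- The direct sum `ρ₁ ⊕ ρ₂ : a → End(V₁ × V₂)` of two families of operators. -/
def prodL (ρ1 : a →ₗ[ℂ] Module.End ℂ V1) (ρ2 : a →ₗ[ℂ] Module.End ℂ V2) :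
    a →ₗ[ℂ] Module.End ℂ (V1 × V2) where
  toFun x := (ρ1 x).prodMap (ρ2 x)
  map_add' x y := by ext v <;> simp
  map_smul' c x := by ext v <;> simp

/-- A linear map `θ̃ : a → Hom(V₁,V₂)` regarded as a map `a → End(V₁ × V₂)` in the obvious
(strictly lower triangular) way. -/
def offDiag (θ : a →ₗ[ℂ] (V1 →ₗ[ℂ] V2)) : a →ₗ[ℂ] Module.End ℂ (V1 × V2) where
  toFun x := (LinearMap.inr ℂ V1 V2) ∘ₗ (θ x) ∘ₗ (LinearMap.fst ℂ V1 V2)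
  map_add' x y := by ext v <;> simp
  map_smul' c x := by ext v <;> simp

/-- The subspace `𝓔(V₁(ρ₁,η₁), V₂(ρ₂,η₂))` of maps `η̃ : a → Hom(V₁,V₂)` such that
`(ρ₁⊕ρ₂, (η₁⊕η₂) + η̃) ∈ ℋ(V₁ × V₂)`. -/
def MemE (τ : TensorAlgebra ℂ a →ₗ[ℂ] a)
    (ρ1 η1 : a →ₗ[ℂ] Module.End ℂ V1) (ρ2 η2 : a →ₗ[ℂ] Module.End ℂ V2)
    (θ : a →ₗ[ℂ] (V1 →ₗ[ℂ] V2)) : Prop :=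
  MemH a τ (prodL a V1 V2 ρ1 ρ2) (prodL a V1 V2 η1 η2 + offDiag a V1 V2 θ)

end

noncomputable section

variable (V1 V2 : Type*) [AddCommGroup V1] [Module ℂ V1] [AddCommGroup V2] [Module ℂ V2]

/-- The ambient space of the pullback `Ũ` used in the Baer sum of two extensions of `V₁` by
`V₂` whose middle terms have underlying space `V₁ × V₂`. -/
abbrev BaerW (V1 V2 : Type*) [AddCommGroup V1] [Module ℂ V1] [AddCommGroup V2] [Module ℂ V2] :
    Type _ := V2 × ((V1 × V2) × (V1 × V2))

/-- Projection onto the `V₁`-component of the first middle term. -/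
def baerP1 : BaerW V1 V2 →ₗ[ℂ] V1 :=
  (LinearMap.fst ℂ V1 V2) ∘ₗ (LinearMap.fst ℂ (V1 × V2) (V1 × V2)) ∘ₗ
    (LinearMap.snd ℂ V2 ((V1 × V2) × (V1 × V2)))

/-- Projection onto the `V₁`-component of the second middle term. -/
def baerP2 : BaerW V1 V2 →ₗ[ℂ] V1 :=
  (LinearMap.fst ℂ V1 V2) ∘ₗ (LinearMap.snd ℂ (V1 × V2) (V1 × V2)) ∘ₗ
    (LinearMap.snd ℂ V2 ((V1 × V2) × (V1 × V2)))

/-- The pullback `Ũ = {(w, u₁, u₂) : π₀(u₁) = π₀(u₂)}`. -/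
def baerU : Submodule ℂ (BaerW V1 V2) := LinearMap.ker (baerP1 V1 V2 - baerP2 V1 V2)

/-- The submodule `N = {(w₁+w₂, -ι₀(w₁), -ι₀(w₂))}` of `Ũ`. -/
def baerN : Submodule ℂ (BaerW V1 V2) :=
  LinearMap.range
    (((LinearMap.fst ℂ V2 V2) + (LinearMap.snd ℂ V2 V2)).prod
      (((LinearMap.inr ℂ V1 V2) ∘ₗ (-(LinearMap.fst ℂ V2 V2))).prod
        ((LinearMap.inr ℂ V1 V2) ∘ₗ (-(LinearMap.snd ℂ V2 V2)))))

/-- The map `Ũ → V₁ × V₂`, `(w, (v, w₁), (v, w₂)) ↦ (v, w + w₁ + w₂)`, implementing the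
identification of the Baer sum with `V(ρ, η + η̃₁ + η̃₂)`. -/
def baerPsi : BaerW V1 V2 →ₗ[ℂ] V1 × V2 :=
  (baerP1 V1 V2).prod
    ((LinearMap.fst ℂ V2 ((V1 × V2) × (V1 × V2))) +
      (LinearMap.snd ℂ V1 V2) ∘ₗ (LinearMap.fst ℂ (V1 × V2) (V1 × V2)) ∘ₗ
        (LinearMap.snd ℂ V2 ((V1 × V2) × (V1 × V2))) +
      (LinearMap.snd ℂ V1 V2) ∘ₗ (LinearMap.snd ℂ (V1 × V2) (V1 × V2)) ∘ₗ
        (LinearMap.snd ℂ V2 ((V1 × V2) × (V1 × V2))))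

/-- The submodule `M = {(-z·w, (0, w))}` of `V₂ × (V₁ × V₂)` used for scalar multiplication of
extension classes. -/
def scalN (z : ℂ) : Submodule ℂ (V2 × (V1 × V2)) :=
  LinearMap.range ((((-z) • LinearMap.id : V2 →ₗ[ℂ] V2)).prod (LinearMap.inr ℂ V1 V2))

/-- The map `V₂ × (V₁ × V₂) → V₁ × V₂`, `(w, (v, w')) ↦ (v, w + z·w')`, implementing the
identification of `z · [V(ρ,η+η̃)]` with `[V(ρ,η+zη̃)]`. -/
def scalPsi (z : ℂ) : (V2 × (V1 × V2)) →ₗ[ℂ] V1 × V2 :=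
  ((LinearMap.fst ℂ V1 V2) ∘ₗ (LinearMap.snd ℂ V2 (V1 × V2))).prod
    ((LinearMap.fst ℂ V2 (V1 × V2)) +
      z • ((LinearMap.snd ℂ V1 V2) ∘ₗ (LinearMap.snd ℂ V2 (V1 × V2))))

end

section Intertwining

variable {a : Type*} [AddCommGroup a] [Module ℂ a]
variable {W W' : Type*} [AddCommGroup W] [Module ℂ W] [AddCommGroup W'] [Module ℂ W']

/-- A subspace stable under all `η x` is stable under the tensor algebra action extending `η`. -/
theorem lift_apply_mem {η : a →ₗ[ℂ] Module.End ℂ W} {S : Submodule ℂ W}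
    (hS : ∀ x, ∀ w ∈ S, η x w ∈ S) (u : TensorAlgebra ℂ a) :
    ∀ w ∈ S, (TensorAlgebra.lift ℂ η u : Module.End ℂ W) w ∈ S := by
  induction u using TensorAlgebra.induction with
  | algebraMap r => intro w hw; simpa [Module.algebraMap_end_apply] using S.smul_mem r hw
  | ι x => intro w hw; simpa using hS x w hw
  | mul u v hu hv => intro w hw; simpa using hu _ (hv w hw)
  | add u v hu hv => intro w hw; simpa using S.add_mem (hu w hw) (hv w hw)

/-- A linear map intertwining `η` and `η'` on an `η`-stable subspace intertwines there the tensor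
algebra actions extending them. -/
theorem map_lift_apply {η : a →ₗ[ℂ] Module.End ℂ W} {η' : a →ₗ[ℂ] Module.End ℂ W'}
    {S : Submodule ℂ W} {f : W →ₗ[ℂ] W'} (hS : ∀ x, ∀ w ∈ S, η x w ∈ S)
    (hf : ∀ x, ∀ w ∈ S, f (η x w) = η' x (f w)) (u : TensorAlgebra ℂ a) :
    ∀ w ∈ S, f ((TensorAlgebra.lift ℂ η u : Module.End ℂ W) w) =
      (TensorAlgebra.lift ℂ η' u : Module.End ℂ W') (f w) := by
  induction u using TensorAlgebra.induction with
  | algebraMap r => intro w hw; simp [Module.algebraMap_end_apply]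
  | ι x => intro w hw; simpa using hf x w hw
  | mul u v hu hv =>
    intro w hw
    simp only [map_mul, Module.End.mul_apply]
    rw [hu _ (lift_apply_mem hS v w hw), hv w hw]
  | add u v hu hv => intro w hw; simp [hu w hw, hv w hw]

end Intertwining

section Coordinates

variable {V1 V2 : Type*} [AddCommGroup V1] [Module ℂ V1] [AddCommGroup V2] [Module ℂ V2]

@[simp]
theorem prodL_apply {a : Type*} [LieRing a] [LieAlgebra ℂ a] (ρ1 : a →ₗ[ℂ] Module.End ℂ V1)
    (ρ2 : a →ₗ[ℂ] Module.End ℂ V2) (x : a) (v : V1 × V2) :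
    prodL a V1 V2 ρ1 ρ2 x v = (ρ1 x v.1, ρ2 x v.2) := rfl

@[simp]
theorem offDiag_apply {a : Type*} [LieRing a] [LieAlgebra ℂ a] (θ : a →ₗ[ℂ] (V1 →ₗ[ℂ] V2))
    (x : a) (v : V1 × V2) : offDiag a V1 V2 θ x v = (0, θ x v.1) := rfl

@[simp]
theorem etaTildeMap_apply {a : Type*} [LieRing a] [LieAlgebra ℂ a]
    (η1 : a →ₗ[ℂ] Module.End ℂ V1) (η2 : a →ₗ[ℂ] Module.End ℂ V2) (ψ : V1 →ₗ[ℂ] V2)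
    (x : a) (v : V1) : etaTildeMap a V1 V2 η1 η2 ψ x v = η2 x (ψ v) - ψ (η1 x v) := rfl

@[simp]
theorem baerP1_apply (w : BaerW V1 V2) : baerP1 V1 V2 w = w.2.1.1 := rfl

@[simp]
theorem baerPsi_apply (w : BaerW V1 V2) :
    baerPsi V1 V2 w = (w.2.1.1, w.1 + w.2.1.2 + w.2.2.2) := rfl

@[simp]
theorem scalPsi_apply (z : ℂ) (w : V2 × (V1 × V2)) :
    scalPsi V1 V2 z w = (w.2.1, w.1 + z • w.2.2) := rfl

@[simp]
theorem mem_baerU {w : BaerW V1 V2} : w ∈ baerU V1 V2 ↔ w.2.1.1 = w.2.2.1 :=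
  sub_eq_zero (a := w.2.1.1)

theorem mem_baerN {w : BaerW V1 V2} :
    w ∈ baerN V1 V2 ↔ w.2.1.1 = 0 ∧ w.2.2.1 = 0 ∧ w.1 + w.2.1.2 + w.2.2.2 = 0 := by
  constructor
  · rintro ⟨y, rfl⟩
    simp
  · obtain ⟨w, ⟨v, w1⟩, v', w2⟩ := w
    rintro ⟨h1, h2, h3⟩
    refine ⟨(-w1, -w2), ?_⟩
    simp only at h1 h2 h3
    have : w = -w1 + -w2 := by rw [← sub_eq_zero, ← h3]; abel
    simp [h1, h2, this]

theorem mem_scalN {z : ℂ} {w : V2 × (V1 × V2)} :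
    w ∈ scalN V1 V2 z ↔ w.2.1 = 0 ∧ w.1 + z • w.2.2 = 0 := by
  constructor
  · rintro ⟨y, rfl⟩
    simp
  · obtain ⟨w, v, w'⟩ := w
    rintro ⟨h1, h2⟩
    refine ⟨w', ?_⟩
    simp only at h1 h2
    simp [h1, eq_neg_of_add_eq_zero_left h2]

/-- The unipotent automorphism `(v₁, v₂) ↦ (v₁, v₂ + ψ v₁)` of `V₁ × V₂`. -/
def shearEquiv (ψ : V1 →ₗ[ℂ] V2) : (V1 × V2) ≃ₗ[ℂ] (V1 × V2) :=
  (LinearEquiv.refl ℂ V1).skewProd (LinearEquiv.refl ℂ V2) ψ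

@[simp]
theorem shearEquiv_apply (ψ : V1 →ₗ[ℂ] V2) (v : V1 × V2) :
    shearEquiv ψ v = (v.1, v.2 + ψ v.1) := rfl

end Coordinates

/-- The map `β̃ : 𝓔 → Ext¹_{a[t]}(V₁(ρ₁,η₁), V₂(ρ₂,η₂))`, `η̃ ↦ [V(ρ,η+η̃)]`,
is linear with respect to the Baer sum and scalar multiplication of extension classes, and its
kernel is exactly `𝓔₀`.  Additivity is expressed via the explicit equivalence of the Baer sum
`Ũ/N` of the extensions `V(ρ,η+η̃₁)`, `V(ρ,η+η̃₂)` with `V(ρ,η+η̃₁+η̃₂)` (the first isomorphism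
theorem data for `Ψ : Ũ → V(ρ,η+η̃₁+η̃₂)`, `(w,(v,w₁),(v,w₂)) ↦ (v,w+w₁+w₂)`), and similarly
scalar multiplication via `(V₂ × V(ρ,η+η̃))/M ≅ V(ρ,η+zη̃)`; the kernel statement says that
`V(ρ,η+η̃) → V(ρ,η)` is split by an `a[t]`-equivalence of extensions iff `η̃ = η̃_ψ` for some
`ψ ∈ Hom_a(V₁,V₂)`. -/
theorem statement13 (a : Type*) [LieRing a] [LieAlgebra ℂ a]
    (h𝔞 : Submodule.span ℂ {z : a | ∃ x y : a, z = ⁅x, y⁆} = ⊤)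
    (τ : TensorAlgebra ℂ a →ₗ[ℂ] a) (hτ : IsTau a τ)
    (V1 V2 : Type*) [AddCommGroup V1] [Module ℂ V1] [AddCommGroup V2] [Module ℂ V2]
    (ρ1 η1 : a →ₗ[ℂ] Module.End ℂ V1) (ρ2 η2 : a →ₗ[ℂ] Module.End ℂ V2)
    (h1 : MemH a τ ρ1 η1) (h2 : MemH a τ ρ2 η2)
    -- abbreviations: `ρP = ρ₁⊕ρ₂`, `ηP = η₁⊕η₂`
    (ρP ηP : a →ₗ[ℂ] Module.End ℂ (V1 × V2))
    (hρP : ρP = prodL a V1 V2 ρ1 ρ2) (hηP : ηP = prodL a V1 V2 η1 η2) :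
    -- β̃ is additive: the Baer sum of `[V(ρ,η+η̃₁)]` and `[V(ρ,η+η̃₂)]` is `[V(ρ,η+η̃₁+η̃₂)]`
    (∀ θ1 θ2 : a →ₗ[ℂ] (V1 →ₗ[ℂ] V2),
      MemE a V1 V2 τ ρ1 η1 ρ2 η2 θ1 → MemE a V1 V2 τ ρ1 η1 ρ2 η2 θ2 →
      ∀ ρW ηW : a →ₗ[ℂ] Module.End ℂ (BaerW V1 V2),
        ρW = prodL a V2 ((V1 × V2) × (V1 × V2)) ρ2
          (prodL a (V1 × V2) (V1 × V2) ρP ρP) →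
        ηW = prodL a V2 ((V1 × V2) × (V1 × V2)) η2
          (prodL a (V1 × V2) (V1 × V2) (ηP + offDiag a V1 V2 θ1) (ηP + offDiag a V1 V2 θ2)) →
        -- the componentwise `a[t]`-action preserves `Ũ` and `N`, so the Baer sum `Ũ/N` is an
        -- `a[t]`-module, and `Ψ` identifies it with `V(ρ,η+η̃₁+η̃₂)` as an extension:
        (∀ x : a, ∀ w ∈ baerU V1 V2, ρW x w ∈ baerU V1 V2) ∧
        (∀ x : a, ∀ w ∈ baerN V1 V2, ρW x w ∈ baerN V1 V2) ∧
        (∀ r : ℕ, ∀ u ∈ Fr a r, ∀ w ∈ baerU V1 V2,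
          (TensorAlgebra.lift ℂ ηW u : Module.End ℂ (BaerW V1 V2)) w ∈ baerU V1 V2) ∧
        (∀ r : ℕ, ∀ u ∈ Fr a r, ∀ w ∈ baerN V1 V2,
          (TensorAlgebra.lift ℂ ηW u : Module.End ℂ (BaerW V1 V2)) w ∈ baerN V1 V2) ∧
        (∀ x : a, ∀ w ∈ baerU V1 V2, baerPsi V1 V2 (ρW x w) = ρP x (baerPsi V1 V2 w)) ∧
        (∀ r : ℕ, ∀ u ∈ Fr a r, ∀ w ∈ baerU V1 V2,
          baerPsi V1 V2 ((TensorAlgebra.lift ℂ ηW u : Module.End ℂ (BaerW V1 V2)) w) =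
            (TensorAlgebra.lift ℂ (ηP + offDiag a V1 V2 (θ1 + θ2)) u :
              Module.End ℂ (V1 × V2)) (baerPsi V1 V2 w)) ∧
        baerN V1 V2 ≤ baerU V1 V2 ∧
        baerU V1 V2 ⊓ LinearMap.ker (baerPsi V1 V2) = baerN V1 V2 ∧
        (∀ v : V1 × V2, ∃ w ∈ baerU V1 V2, baerPsi V1 V2 w = v) ∧
        (∀ w : V2, baerPsi V1 V2 (w, 0) = (0, w)) ∧
        (∀ w ∈ baerU V1 V2, (baerPsi V1 V2 w).1 = baerP1 V1 V2 w)) ∧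
    -- β̃ is homogeneous: `z·[V(ρ,η+η̃)] = [V(ρ,η+zη̃)]`
    (∀ (z : ℂ) (θ : a →ₗ[ℂ] (V1 →ₗ[ℂ] V2)), MemE a V1 V2 τ ρ1 η1 ρ2 η2 θ →
      ∀ ρW ηW : a →ₗ[ℂ] Module.End ℂ (V2 × (V1 × V2)),
        ρW = prodL a V2 (V1 × V2) ρ2 ρP →
        ηW = prodL a V2 (V1 × V2) η2 (ηP + offDiag a V1 V2 θ) →
        (∀ x : a, ∀ w ∈ scalN V1 V2 z, ρW x w ∈ scalN V1 V2 z) ∧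
        (∀ r : ℕ, ∀ u ∈ Fr a r, ∀ w ∈ scalN V1 V2 z,
          (TensorAlgebra.lift ℂ ηW u : Module.End ℂ (V2 × (V1 × V2))) w ∈ scalN V1 V2 z) ∧
        (∀ x : a, ∀ w : V2 × (V1 × V2),
          scalPsi V1 V2 z (ρW x w) = ρP x (scalPsi V1 V2 z w)) ∧
        (∀ r : ℕ, ∀ u ∈ Fr a r, ∀ w : V2 × (V1 × V2),
          scalPsi V1 V2 z ((TensorAlgebra.lift ℂ ηW u : Module.End ℂ (V2 × (V1 × V2))) w) =
            (TensorAlgebra.lift ℂ (ηP + offDiag a V1 V2 (z • θ)) u :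
              Module.End ℂ (V1 × V2)) (scalPsi V1 V2 z w)) ∧
        LinearMap.ker (scalPsi V1 V2 z) = scalN V1 V2 z ∧
        Function.Surjective (scalPsi V1 V2 z) ∧
        (∀ w : V2, scalPsi V1 V2 z (w, 0) = (0, w)) ∧
        (∀ w : V2 × (V1 × V2), (scalPsi V1 V2 z w).1 = w.2.1)) ∧
    -- the kernel of β̃ is exactly `𝓔₀`
    (∀ θ : a →ₗ[ℂ] (V1 →ₗ[ℂ] V2), MemE a V1 V2 τ ρ1 η1 ρ2 η2 θ →
      ((∃ Ψ : (V1 × V2) ≃ₗ[ℂ] (V1 × V2),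
          IsCurHom a ρP (ηP + offDiag a V1 V2 θ) ρP ηP Ψ.toLinearMap ∧
          (∀ v2 : V2, Ψ (0, v2) = ((0, v2) : V1 × V2)) ∧
          (∀ v : V1 × V2, (Ψ v).1 = v.1)) ↔
        (∃ ψ ∈ homA a V1 V2 ρ1 ρ2, θ = etaTildeMap a V1 V2 η1 η2 ψ))) := by
  subst hρP hηP
  refine ⟨?_, ?_, ?_⟩
  · rintro θ1 θ2 - - ρW ηW rfl rfl
    have hρU : ∀ x : a, ∀ w ∈ baerU V1 V2, prodL a V2 ((V1 × V2) × (V1 × V2)) ρ2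
        (prodL a (V1 × V2) (V1 × V2) (prodL a V1 V2 ρ1 ρ2) (prodL a V1 V2 ρ1 ρ2)) x w ∈
          baerU V1 V2 := by
      intro x w hw
      rw [mem_baerU] at hw ⊢
      simp [hw]
    have hηU : ∀ x : a, ∀ w ∈ baerU V1 V2, prodL a V2 ((V1 × V2) × (V1 × V2)) η2
        (prodL a (V1 × V2) (V1 × V2) (prodL a V1 V2 η1 η2 + offDiag a V1 V2 θ1)
          (prodL a V1 V2 η1 η2 + offDiag a V1 V2 θ2)) x w ∈ baerU V1 V2 := by
      intro x w hw
      rw [mem_baerU] at hw ⊢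
      simp [hw]
    refine ⟨hρU, ?_, fun _ u _ => lift_apply_mem hηU u, fun _ u _ => lift_apply_mem ?_ u, ?_,
      fun _ u _ => map_lift_apply hηU ?_ u, ?_, ?_, ?_, ?_, ?_⟩
    · intro x w hw
      obtain ⟨hv, hv', hs⟩ := mem_baerN.1 hw
      refine mem_baerN.2 ⟨by simp [hv], by simp [hv'], ?_⟩
      simpa using congrArg (ρ2 x) hs
    · intro x w hw
      obtain ⟨hv, hv', hs⟩ := mem_baerN.1 hw
      refine mem_baerN.2 ⟨by simp [hv], by simp [hv'], ?_⟩
      simpa [hv, hv'] using congrArg (η2 x) hs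
    · intro x w _
      simp
    · intro x w hw
      rw [mem_baerU] at hw
      simp [← hw]
      abel
    · intro w hw
      obtain ⟨hv, hv', -⟩ := mem_baerN.1 hw
      rw [mem_baerU, hv, hv']
    · ext w
      simp only [Submodule.mem_inf, mem_baerU, LinearMap.mem_ker, baerPsi_apply, mem_baerN,
        Prod.mk_eq_zero]
      constructor
      · rintro ⟨h, hv, hs⟩
        exact ⟨hv, h ▸ hv, hs⟩
      · rintro ⟨hv, hv', hs⟩
        exact ⟨hv.trans hv'.symm, hv, hs⟩
    · intro v
      exact ⟨(v.2, (v.1, 0), (v.1, 0)), by simp, by simp⟩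
    · intro w
      simp
    · intro w _
      simp
  · rintro z θ - ρW ηW rfl rfl
    refine ⟨?_, fun _ u _ => lift_apply_mem ?_ u, ?_,
      fun _ u _ w => map_lift_apply (S := ⊤) (fun _ _ _ => trivial) ?_ u w trivial,
      ?_, ?_, ?_, ?_⟩
    · intro x w hw
      obtain ⟨hv, hs⟩ := mem_scalN.1 hw
      refine mem_scalN.2 ⟨by simp [hv], ?_⟩
      simpa using congrArg (ρ2 x) hs
    · intro x w hw
      obtain ⟨hv, hs⟩ := mem_scalN.1 hw
      refine mem_scalN.2 ⟨by simp [hv], ?_⟩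
      simpa [hv] using congrArg (η2 x) hs
    · intro x w
      simp
    · intro x w _
      simp [add_assoc]
    · ext w
      simp [mem_scalN]
    · intro v
      exact ⟨(v.2, (v.1, 0)), by simp⟩
    · intro w
      simp
    · intro w
      simp
  · intro θ _
    constructor
    · rintro ⟨Ψ, ⟨hΨρ, hΨη⟩, hι, hπ⟩
      have hΨ : ∀ v1 v2, Ψ (v1, v2) = (v1, v2 + (Ψ (v1, 0)).2) := by
        intro v1 v2
        have h : ((v1, v2) : V1 × V2) = (0, v2) + (v1, 0) := by simp
        refine Prod.ext (hπ _) ?_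
        rw [h, map_add, hι]
        rfl
      let ψ : V1 →ₗ[ℂ] V2 := LinearMap.snd ℂ V1 V2 ∘ₗ Ψ.toLinearMap ∘ₗ LinearMap.inl ℂ V1 V2
      have hψ : ∀ v1 v2, Ψ (v1, v2) = (v1, v2 + ψ v1) := hΨ
      refine ⟨ψ, fun x => ?_, ?_⟩
      · ext v
        have h := congrArg Prod.snd (LinearMap.congr_fun (hΨρ x) (v, 0))
        simpa [hψ] using h
      · ext x v
        have h := congrArg Prod.snd
          (LinearMap.congr_fun (hΨη 1 (TensorAlgebra.ι ℂ x) ⟨x, rfl⟩) (v, 0))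
        simp [hψ] at h
        rw [etaTildeMap_apply, ← h, add_sub_cancel_right]
    · rintro ⟨ψ, hψ, rfl⟩
      refine ⟨shearEquiv ψ, ⟨fun x => ?_, fun _ u _ => ?_⟩, fun v2 => by simp, fun v => by simp⟩
      · have h := fun v => LinearMap.congr_fun (hψ x) v
        simp only [LinearMap.comp_apply] at h
        refine LinearMap.ext fun v => ?_
        simp [h]
      · refine LinearMap.ext fun w => map_lift_apply (f := (shearEquiv ψ).toLinearMap)
          (S := ⊤) (fun _ _ _ => trivial) ?_ u w trivial
        intro x v _
        simp
        abel
end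

section
/- Suppose Ext¹_𝔞(V_1, V_2) = 0, i.e. every extension of V_2 by V_1 in the category of 𝔞-modules splits. Then the map β̃ : 𝓔(V_1(ρ_1,η_1), V_2(ρ_2,η_2)) → Ext¹_{𝔞[t]}(V_1(ρ_1,η_1), V_2(ρ_2,η_2)) sending η̃ to the class of (V(ρ,η+η̃), ι_0, π_0) is surjective. -/
open TensorAlgebra TensorProduct Polynomial

section Transport

variable {a : Type*} [LieRing a] [LieAlgebra ℂ a]
variable {V W : Type*} [AddCommGroup V] [Module ℂ V] [AddCommGroup W] [Module ℂ W]

/-- A linear map intertwining `η` and `η'` intertwines the induced actions of `T(a)`. -/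
theorem comp_lift_eq_lift_comp {η : a →ₗ[ℂ] Module.End ℂ V} {η' : a →ₗ[ℂ] Module.End ℂ W}
    {φ : V →ₗ[ℂ] W} (h : ∀ x, φ ∘ₗ η x = η' x ∘ₗ φ) (u : TensorAlgebra ℂ a) :
    φ ∘ₗ (TensorAlgebra.lift ℂ η u : Module.End ℂ V)
      = (TensorAlgebra.lift ℂ η' u : Module.End ℂ W) ∘ₗ φ := by
  induction u using TensorAlgebra.induction with
  | algebraMap r =>
    ext v
    simp [Module.algebraMap_end_apply]
  | ι x => simpa using h x
  | mul u v hu hv =>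
    rw [map_mul, map_mul, Module.End.mul_eq_comp, Module.End.mul_eq_comp, ← LinearMap.comp_assoc,
      hu, LinearMap.comp_assoc, hv, LinearMap.comp_assoc]
  | add u v hu hv => rw [map_add, map_add, LinearMap.comp_add, LinearMap.add_comp, hu, hv]

theorem isCurHom_of_comp_eq {ρ η : a →ₗ[ℂ] Module.End ℂ V} {ρ' η' : a →ₗ[ℂ] Module.End ℂ W}
    {φ : V →ₗ[ℂ] W} (hρ : ∀ x, φ ∘ₗ ρ x = ρ' x ∘ₗ φ) (hη : ∀ x, φ ∘ₗ η x = η' x ∘ₗ φ) :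
    IsCurHom a ρ η ρ' η' φ :=
  ⟨hρ, fun _ u _ => comp_lift_eq_lift_comp hη u⟩

theorem IsCurHom.comp_eq {ρ η : a →ₗ[ℂ] Module.End ℂ V} {ρ' η' : a →ₗ[ℂ] Module.End ℂ W}
    {φ : V →ₗ[ℂ] W} (h : IsCurHom a ρ η ρ' η' φ) (x : a) : φ ∘ₗ η x = η' x ∘ₗ φ := by
  have hx : TensorAlgebra.ι ℂ x ∈ Fr a 1 := by
    rw [Fr]
    exact LinearMap.mem_range_self _ x
  simpa using h.2 1 _ hx

/-- Membership in `ℋ` passes to submodules. -/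
theorem MemH.of_injective {τ : TensorAlgebra ℂ a →ₗ[ℂ] a}
    {ρ η : a →ₗ[ℂ] Module.End ℂ V} {ρ' η' : a →ₗ[ℂ] Module.End ℂ W} (h : MemH a τ ρ' η')
    {φ : V →ₗ[ℂ] W} (hφ : Function.Injective φ)
    (hρ : ∀ x, φ ∘ₗ ρ x = ρ' x ∘ₗ φ) (hη : ∀ x, φ ∘ₗ η x = η' x ∘ₗ φ) : MemH a τ ρ η := by
  have hρ' (x v) : φ (ρ x v) = ρ' x (φ v) := LinearMap.congr_fun (hρ x) v
  have hη' (x v) : φ (η x v) = η' x (φ v) := LinearMap.congr_fun (hη x) v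
  refine ⟨fun x y => ?_, fun x y => ?_, fun r u hu hτu => ?_⟩
  · ext v
    apply hφ
    simp [hρ', h.1, LieRing.of_associative_ring_bracket]
  · ext v
    apply hφ
    simp [hρ', hη', h.2.1, LieRing.of_associative_ring_bracket]
  · ext v
    apply hφ
    have := LinearMap.congr_fun (comp_lift_eq_lift_comp hη u) v
    rw [h.2.2 r u hu hτu] at this
    simpa using this

end Transport

/-- A section of a short exact sequence identifies the middle term with the direct sum. -/
theorem bijective_coprod_of_section {R V1 V2 U : Type*} [Ring R]
    [AddCommGroup V1] [Module R V1] [AddCommGroup V2] [Module R V2] [AddCommGroup U] [Module R U]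
    {i : V2 →ₗ[R] U} {p : U →ₗ[R] V1} {s : V1 →ₗ[R] U} (hi : Function.Injective i)
    (hip : LinearMap.range i = LinearMap.ker p) (hs : p ∘ₗ s = LinearMap.id) :
    Function.Bijective (s.coprod i) := by
  have hps (v) : p (s v) = v := LinearMap.congr_fun hs v
  have hpi (w) : p (i w) = 0 := by
    rw [← LinearMap.mem_ker, ← hip]
    exact LinearMap.mem_range_self i w
  constructor
  · rw [injective_iff_map_eq_zero]
    rintro ⟨v, w⟩ h
    rw [LinearMap.coprod_apply] at h
    have hv : v = 0 := by simpa [hps, hpi] using congrArg p h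
    subst hv
    have hw : w = 0 := hi (by simpa using h)
    simp [hw]
  · intro u
    have hu : u - s (p u) ∈ LinearMap.range i := by simp [hip, hps]
    obtain ⟨w, hw⟩ := hu
    exact ⟨(p u, w), by simp [hw]⟩

universe u

/-- Suppose `Ext¹_a(V₁, V₂) = 0`, i.e. every extension of `V₂` by `V₁` in the
category of `a`-modules splits.  Then `β̃ : 𝓔(V₁(ρ₁,η₁), V₂(ρ₂,η₂)) →
Ext¹_{a[t]}(V₁(ρ₁,η₁), V₂(ρ₂,η₂))`, `η̃ ↦ [(V(ρ,η+η̃), ι₀, π₀)]`, is surjective: every extension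
of `a[t]`-modules `0 → V₂ → U → V₁ → 0` is equivalent to one of the form
`(V(ρ,η+η̃), ι₀, π₀)`. -/
theorem statement14 (a : Type u) [LieRing a] [LieAlgebra ℂ a]
    (h𝔞 : Submodule.span ℂ {z : a | ∃ x y : a, z = ⁅x, y⁆} = ⊤)
    (τ : TensorAlgebra ℂ a →ₗ[ℂ] a) (hτ : IsTau a τ)
    (V1 V2 : Type u) [AddCommGroup V1] [Module ℂ V1] [AddCommGroup V2] [Module ℂ V2]
    (ρ1 η1 : a →ₗ[ℂ] Module.End ℂ V1) (ρ2 η2 : a →ₗ[ℂ] Module.End ℂ V2)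
    (h1 : MemH a τ ρ1 η1) (h2 : MemH a τ ρ2 η2)
    -- `Ext¹_a(V₁,V₂) = 0` : every extension of `a`-modules of `V₂` by `V₁` splits
    (hExt : ∀ (W : Type u) (_ : AddCommGroup W) (_ : Module ℂ W)
      (ρW : a →ₗ[ℂ] Module.End ℂ W) (_ : ∀ x y : a, ρW ⁅x, y⁆ = ⁅ρW x, ρW y⁆)
      (i : V2 →ₗ[ℂ] W) (p : W →ₗ[ℂ] V1)
      (_ : ∀ x : a, i ∘ₗ ρ2 x = ρW x ∘ₗ i) (_ : ∀ x : a, p ∘ₗ ρW x = ρ1 x ∘ₗ p)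
      (_ : Function.Injective i) (_ : Function.Surjective p)
      (_ : LinearMap.range i = LinearMap.ker p),
      ∃ s : V1 →ₗ[ℂ] W, (∀ x : a, s ∘ₗ ρ1 x = ρW x ∘ₗ s) ∧ p ∘ₗ s = LinearMap.id) :
    -- every extension of `a[t]`-modules of `V₂(ρ₂,η₂)` by `V₁(ρ₁,η₁)` is equivalent to some
    -- `(V(ρ,η+η̃), ι₀, π₀)` with `η̃ ∈ 𝓔`
    ∀ (U : Type u) (_ : AddCommGroup U) (_ : Module ℂ U)
      (ρU ηU : a →ₗ[ℂ] Module.End ℂ U) (_ : MemH a τ ρU ηU)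
      (i : V2 →ₗ[ℂ] U) (p : U →ₗ[ℂ] V1)
      (_ : IsCurHom a ρ2 η2 ρU ηU i) (_ : IsCurHom a ρU ηU ρ1 η1 p)
      (_ : Function.Injective i) (_ : Function.Surjective p)
      (_ : LinearMap.range i = LinearMap.ker p),
      ∃ θ : a →ₗ[ℂ] (V1 →ₗ[ℂ] V2),
        MemE a V1 V2 τ ρ1 η1 ρ2 η2 θ ∧
        ∃ Ψ : (V1 × V2) ≃ₗ[ℂ] U,
          IsCurHom a (prodL a V1 V2 ρ1 ρ2) (prodL a V1 V2 η1 η2 + offDiag a V1 V2 θ)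
            ρU ηU Ψ.toLinearMap ∧
          (∀ v2 : V2, Ψ (0, v2) = i v2) ∧
          (∀ v : V1 × V2, p (Ψ v) = v.1) := by
  intro U _ _ ρU ηU hU i p hi hp hinj hsurj hip
  obtain ⟨s, hsρ, hs⟩ := hExt U _ _ ρU hU.1 i p hi.1 hp.1 hinj hsurj hip
  let Ψ : (V1 × V2) ≃ₗ[ℂ] U :=
    LinearEquiv.ofBijective (s.coprod i) (bijective_coprod_of_section hinj hip hs)
  have hΨ (v) : Ψ v = s v.1 + i v.2 := rfl
  have hpΨ (v) : p (Ψ v) = v.1 := by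
    have hps : p (s v.1) = v.1 := LinearMap.congr_fun hs v.1
    have hpi : p (i v.2) = 0 := by
      rw [← LinearMap.mem_ker, ← hip]
      exact LinearMap.mem_range_self i v.2
    rw [hΨ, map_add, hps, hpi, add_zero]
  let θ : a →ₗ[ℂ] (V1 →ₗ[ℂ] V2) :=
    (LinearMap.lcomp ℂ V2 s) ∘ₗ
      (LinearMap.llcomp ℂ U U V2 (LinearMap.snd ℂ V1 V2 ∘ₗ Ψ.symm.toLinearMap)) ∘ₗ ηU
  have hθ (x v) : θ x v = (Ψ.symm (ηU x (s v))).2 := rfl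
  have hηs (x v) : ηU x (s v) = s (η1 x v) + i (θ x v) := by
    have hfst : (Ψ.symm (ηU x (s v))).1 = η1 x v := by
      rw [← hpΨ, Ψ.apply_symm_apply]
      exact (LinearMap.congr_fun (hp.comp_eq x) (s v)).trans
        (congrArg (η1 x) (LinearMap.congr_fun hs v))
    rw [hθ, ← hfst, ← hΨ, Ψ.apply_symm_apply]
  have hΨρ (x) : Ψ.toLinearMap ∘ₗ prodL a V1 V2 ρ1 ρ2 x = ρU x ∘ₗ Ψ.toLinearMap := by
    refine LinearMap.ext fun v => ?_
    have hv₁ : s (ρ1 x v.1) = ρU x (s v.1) := LinearMap.congr_fun (hsρ x) v.1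
    have hv₂ : i (ρ2 x v.2) = ρU x (i v.2) := LinearMap.congr_fun (hi.1 x) v.2
    simp [hΨ, prodL, hv₁, hv₂]
  have hΨη (x) : Ψ.toLinearMap ∘ₗ (prodL a V1 V2 η1 η2 + offDiag a V1 V2 θ) x
      = ηU x ∘ₗ Ψ.toLinearMap := by
    refine LinearMap.ext fun v => ?_
    have hv : i (η2 x v.2) = ηU x (i v.2) := LinearMap.congr_fun (hi.comp_eq x) v.2
    simp only [LinearMap.comp_apply, LinearEquiv.coe_coe, hΨ, map_add, hηs, ← hv]
    simp [prodL, offDiag]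
    abel
  exact ⟨θ, hU.of_injective Ψ.injective hΨρ hΨη, Ψ, isCurHom_of_comp_eq hΨρ hΨη,
    fun v => by simp [hΨ], hpΨ⟩
end
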